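/- arXiv:2512.19335 — 2 statements merged into one kernel-verified Lean document; each statement's English description precedes it below -/
import Mathlib

section
/- For every natural number k ≥ 1, the third group cohomology H³(Q; ℤ) with trivial coefficients ℤ of the generalized quaternion group Q of order 2^(k+2) (in Lean: QuaternionGroup (2^k), the dicyclic group of order 4·2^k) is trivial. -/
namespace AF9

/-- Homomorphisms out of the dicyclic group from the presentation. -/
theorem exists_hom {n : ℕ} {E : Type*} [Group E] (A X : E)
    (h1 : X * A * X⁻¹ = A⁻¹) (h2 : X * X = A ^ n) :
    ∃ s : QuaternionGroup n →* E, s (.a 1) = A ∧ s (.xa 0) = X := by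
  have hz : ∀ m : ℤ, X * A ^ m * X⁻¹ = A ^ (-m) := by
    intro m
    rw [← conj_zpow, h1, inv_zpow, zpow_neg]
  have hA : A ^ (2 * n) = 1 := by
    have h3 := hz n
    rw [zpow_neg, zpow_natCast, ← h2] at h3
    have h4 : X * X = (X * X)⁻¹ := by
      rw [← h3]; group
    rw [mul_comm 2 n, pow_mul, ← h2, pow_two]
    nth_rewrite 1 [h4]
    group
  let φ : ZMod (2 * n) →+ Additive E :=
    ZMod.lift (2 * n) ⟨zmultiplesHom (Additive E) (Additive.ofMul A), by
      rw [zmultiplesHom_apply, ← ofMul_zpow, zpow_natCast, hA]; rfl⟩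
  let P : ZMod (2 * n) → E := fun i => (φ i).toMul
  have hP : ∀ m : ℤ, P (m : ZMod (2 * n)) = A ^ m := by
    intro m
    simp only [P, φ, ZMod.lift_coe]
    rw [zmultiplesHom_apply, ← ofMul_zpow]; rfl
  have hadd : ∀ i j, P (i + j) = P i * P j := by
    intro i j
    simp only [P, map_add]; rfl
  have hc : ∀ i, P i * X = X * P (-i) := by
    intro i
    obtain ⟨m, rfl⟩ := ZMod.intCast_surjective i
    rw [← Int.cast_neg, hP, hP]
    have := hz (-m)
    rw [neg_neg] at this
    rw [← this]; group
  have hn : P (n : ZMod (2 * n)) = X * X := by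
    have := hP n
    rw [Int.cast_natCast] at this
    rw [this, h2, zpow_natCast]
  have h0 : P 0 = 1 := by simpa using hP 0
  have hone : P 1 = A := by simpa using hP 1
  refine ⟨MonoidHom.mk' (fun g => match g with
    | .a i => P i
    | .xa i => X * P i) ?_, ?_, ?_⟩
  · rintro (i | i) (j | j)
    · simp only [QuaternionGroup.a_mul_a, hadd]
    · simp only [QuaternionGroup.a_mul_xa]
      rw [← mul_assoc, hc, mul_assoc, ← hadd, neg_add_eq_sub]
    · simp only [QuaternionGroup.xa_mul_a, hadd, mul_assoc]
    · simp only [QuaternionGroup.xa_mul_xa]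
      rw [mul_assoc, ← mul_assoc (P i), hc, mul_assoc X (P (-i)), ← hadd, ← mul_assoc, ← hn,
        ← hadd]
      congr 1; ring
  · simpa using hone
  · simp [h0]

/-- The central extension of `G` by `D` attached to a 2-cocycle. -/
structure Ext {G D : Type} (h : G → G → D) where
  d : D
  g : G

section
variable {G D : Type} [Group G] [AddCommGroup D] (h : G → G → D)

theorem norm_l (H : ∀ a b c, h b c - h (a * b) c + h a (b * c) - h a b = 0) (a : G) :
    h 1 a = h 1 1 := by
  have := H 1 1 a
  simp only [one_mul, mul_one] at this
  rw [sub_self, zero_add, sub_eq_zero] at this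
  exact this

theorem norm_r (H : ∀ a b c, h b c - h (a * b) c + h a (b * c) - h a b = 0) (a : G) :
    h a 1 = h 1 1 := by
  have := H a 1 1
  simp only [mul_one] at this
  rw [add_sub_cancel_right, sub_eq_zero] at this
  exact this.symm

/-- Group structure on the extension. -/
@[reducible] def extGroup (H : ∀ a b c, h b c - h (a * b) c + h a (b * c) - h a b = 0) :
    Group (Ext h) :=
  letI : Mul (Ext h) := ⟨fun x y => ⟨x.d + y.d + h x.g y.g, x.g * y.g⟩⟩
  letI : One (Ext h) := ⟨⟨-h 1 1, 1⟩⟩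
  letI : Inv (Ext h) := ⟨fun x => ⟨-x.d - h 1 1 - h x.g⁻¹ x.g, x.g⁻¹⟩⟩
  Group.ofLeftAxioms
    (by
      rintro ⟨d, a⟩ ⟨e, b⟩ ⟨f, c⟩
      change Ext.mk _ _ = Ext.mk _ _
      rw [Ext.mk.injEq]
      refine ⟨?_, mul_assoc a b c⟩
      change d + e + h a b + f + h (a * b) c = d + (e + f + h b c) + h a (b * c)
      have := H a b c
      rw [← sub_eq_zero, ← neg_eq_zero, ← this]
      abel)
    (by
      rintro ⟨d, a⟩
      change Ext.mk _ _ = Ext.mk _ _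
      rw [Ext.mk.injEq]
      refine ⟨?_, one_mul a⟩
      change -h 1 1 + d + h 1 a = d
      rw [norm_l h H a]; abel)
    (by
      rintro ⟨d, a⟩
      change Ext.mk _ _ = Ext.mk _ _
      rw [Ext.mk.injEq]
      refine ⟨?_, inv_mul_cancel a⟩
      change -d - h 1 1 - h a⁻¹ a + d + h a⁻¹ a = -h 1 1
      abel)

end

/-- `H²(Q; D) = 0` for 2-divisible `D`. -/
theorem split {n : ℕ} {D : Type} [AddCommGroup D] (hdiv : ∀ d : D, ∃ e, e + e = d)
    (h : QuaternionGroup n → QuaternionGroup n → D)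
    (H : ∀ a b c, h b c - h (a * b) c + h a (b * c) - h a b = 0) :
    ∃ u : QuaternionGroup n → D, ∀ a b, h a b = u a + u b - u (a * b) := by
  letI := extGroup h H
  have hmul : ∀ x y : Ext h, x * y = ⟨x.d + y.d + h x.g y.g, x.g * y.g⟩ := fun _ _ => rfl
  have hone : (1 : Ext h) = ⟨-h 1 1, 1⟩ := rfl
  let p : Ext h →* QuaternionGroup n := MonoidHom.mk' Ext.g (fun _ _ => rfl)
  have hp : ∀ x, p x = x.g := fun _ => rfl
  let ι : D → Ext h := fun d => ⟨d - h 1 1, 1⟩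
  have hι : ∀ d e, ι (d + e) = ι d * ι e := by
    intro d e
    rw [hmul]
    simp only [ι, Ext.mk.injEq, mul_one, and_true]
    abel
  have hcomm : ∀ d x, ι d * x = x * ι d := by
    intro d x
    rw [hmul, hmul]
    simp only [ι, Ext.mk.injEq, mul_one, one_mul, and_true]
    rw [norm_l h H x.g, norm_r h H x.g]; abel
  have hpι : ∀ d, p (ι d) = 1 := fun _ => rfl
  have hι0 : ι 0 = 1 := by simp [ι, hone]
  have hker : ∀ x, p x = 1 → ∃ d, x = ι d := by
    rintro ⟨d, g⟩ hx
    rw [hp] at hx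
    simp only at hx
    subst hx
    exact ⟨d + h 1 1, by simp [ι]⟩
  -- every `ι d` is the inverse of a square
  have hsq : ∀ d, ∃ e, ι e * ι e * ι d = 1 := by
    intro d
    obtain ⟨e, he⟩ := hdiv (-d)
    exact ⟨e, by rw [← hι, ← hι, he, neg_add_cancel, hι0]⟩
  obtain ⟨A, X, hA, hX, h1, h2⟩ : ∃ A X : Ext h, p A = .a 1 ∧ p X = .xa 0 ∧
      X * A * X⁻¹ = A⁻¹ ∧ X * X = A ^ n := by
    let A0 : Ext h := ⟨0, .a 1⟩
    let X0 : Ext h := ⟨0, .xa 0⟩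
    have pA0 : p A0 = .a 1 := rfl
    have pX0 : p X0 = .xa 0 := rfl
    obtain ⟨d, hd⟩ := hker (X0 * A0 * X0⁻¹ * A0) (by
      simp only [map_mul, map_inv, pA0, pX0]
      rw [mul_assoc, mul_assoc, mul_eq_one_iff_eq_inv', ← mul_assoc]
      change _ = QuaternionGroup.xa _
      change QuaternionGroup.a _ * QuaternionGroup.xa _ * _ = _
      simp)
    obtain ⟨e, he⟩ := hsq d
    have hA1 : X0 * (ι e * A0) * X0⁻¹ = (ι e * A0)⁻¹ := by
      rw [eq_inv_iff_mul_eq_one]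
      calc X0 * (ι e * A0) * X0⁻¹ * (ι e * A0)
          = (X0 * ι e) * A0 * X0⁻¹ * ι e * A0 := by group
        _ = ι e * (X0 * A0 * X0⁻¹ * ι e) * A0 := by rw [← hcomm e X0]; group
        _ = ι e * ι e * (X0 * A0 * X0⁻¹ * A0) := by rw [← hcomm]; group
        _ = 1 := by rw [hd, he]
    set A := ι e * A0 with hAdef
    have pA : p A = .a 1 := by rw [hAdef, map_mul, hpι, one_mul, pA0]
    obtain ⟨d', hd'⟩ := hker (X0 * X0 * (A ^ n)⁻¹) (by
      rw [map_mul, map_inv, map_pow, map_mul, pA, pX0, mul_inv_eq_one]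
      simp)
    obtain ⟨f, hf⟩ := hsq d'
    refine ⟨A, ι f * X0, pA, by rw [map_mul, hpι, one_mul, pX0], ?_, ?_⟩
    · calc ι f * X0 * A * (ι f * X0)⁻¹ = ι f * (X0 * A * X0⁻¹) * (ι f)⁻¹ := by group
        _ = A⁻¹ := by rw [hcomm, hA1]; group
    · rw [← mul_inv_eq_one]
      calc ι f * X0 * (ι f * X0) * (A ^ n)⁻¹ = ι f * (X0 * ι f) * X0 * (A ^ n)⁻¹ := by group
        _ = ι f * ι f * (X0 * X0 * (A ^ n)⁻¹) := by rw [← hcomm]; group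
        _ = 1 := by rw [hd', hf]
  obtain ⟨s, sA, sX⟩ := exists_hom A X h1 h2
  have sa : ∀ i, p (s (.a i)) = .a i := by
    intro i
    obtain ⟨m, rfl⟩ := ZMod.intCast_surjective i
    have hm : (QuaternionGroup.a (m : ZMod (2 * n)) : QuaternionGroup n) = (.a 1) ^ m := by
      cases m with
      | ofNat m => simp
      | negSucc m =>
        rw [zpow_negSucc, QuaternionGroup.a_one_pow, eq_inv_iff_mul_eq_one,
          QuaternionGroup.a_mul_a, QuaternionGroup.one_def]
        congr 1
        push_cast
        ring
    rw [hm, map_zpow, map_zpow, sA, hA]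
  have sp : ∀ g, (s g).g = g := by
    rintro (i | i)
    · exact sa i
    · have : (QuaternionGroup.xa i : QuaternionGroup n) = .xa 0 * .a i := by simp
      rw [← hp, this, map_mul, map_mul, sX, hX, sa]
  refine ⟨fun g => -(s g).d, fun a b => ?_⟩
  have := congrArg Ext.d (map_mul s a b)
  rw [hmul] at this
  simp only [sp] at this
  simp only [this]
  abel

/-- Cochain-level vanishing of `H³(Q; ℤ)`. -/
theorem cochain {n : ℕ} [NeZero n] (f : QuaternionGroup n → QuaternionGroup n →
      QuaternionGroup n → ℤ)
    (hf : ∀ a b c e, f b c e - f (a * b) c e + f a (b * c) e - f a b (c * e) + f a b c = 0) :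
    ∃ w : QuaternionGroup n → QuaternionGroup n → ℤ,
      ∀ a b c, f a b c = w b c - w (a * b) c + w a (b * c) - w a b := by
  let N : ℚ := (Fintype.card (QuaternionGroup n) : ℚ)
  have hN : N ≠ 0 := by simp [N]
  let S : QuaternionGroup n → QuaternionGroup n → ℤ := fun a b => ∑ e, f a b e
  have hS : ∀ a b c, S b c - S (a * b) c + S a (b * c) - S a b
      + (Fintype.card (QuaternionGroup n) : ℤ) * f a b c = 0 := by
    intro a b c
    have h1 : ∑ e, (f b c e - f (a * b) c e + f a (b * c) e - f a b (c * e) + f a b c) = 0 :=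
      Finset.sum_eq_zero fun e _ => hf a b c e
    have h2 : ∑ e, f a b (c * e) = S a b :=
      Fintype.sum_equiv (Equiv.mulLeft c) _ _ (fun _ => rfl)
    rw [Finset.sum_add_distrib, Finset.sum_sub_distrib, Finset.sum_add_distrib,
      Finset.sum_sub_distrib, h2] at h1
    simpa using h1
  let h : QuaternionGroup n → QuaternionGroup n → ℚ := fun a b => -(S a b : ℚ) / N
  have hh : ∀ a b c, h b c - h (a * b) c + h a (b * c) - h a b = f a b c := by
    intro a b c
    have h1 : ((S b c - S (a * b) c + S a (b * c) - S a b
      + (Fintype.card (QuaternionGroup n) : ℤ) * f a b c : ℤ) : ℚ) = 0 := by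
      rw [hS]; simp
    push_cast at h1
    simp only [h]
    field_simp
    change _ = N * _
    linarith
  let q : ℚ →+ ℚ ⧸ (AddSubgroup.zmultiples (1 : ℚ)) := QuotientAddGroup.mk' _
  have hq0 : ∀ x, q x = 0 → ∃ m : ℤ, x = m := by
    intro x hx
    have := (QuotientAddGroup.eq_zero_iff x).1 hx
    obtain ⟨m, hm⟩ := AddSubgroup.mem_zmultiples_iff.1 this
    exact ⟨m, by rw [← hm]; simp⟩
  have hqi : ∀ m : ℤ, q m = 0 := by
    intro m
    refine (QuotientAddGroup.eq_zero_iff _).2 (AddSubgroup.mem_zmultiples_iff.2 ⟨m, by simp⟩)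
  have hqs : Function.Surjective q := QuotientAddGroup.mk'_surjective _
  obtain ⟨u, hu⟩ := split (n := n) (D := ℚ ⧸ (AddSubgroup.zmultiples (1 : ℚ)))
    (by
      intro d
      obtain ⟨x, rfl⟩ := hqs d
      exact ⟨q (x / 2), by rw [← map_add]; congr 1; ring⟩)
    (fun a b => q (h a b))
    (by
      intro a b c
      rw [← map_sub, ← map_add, ← map_sub, hh, hqi])
  choose v hv using fun g => hqs (u g)
  have key : ∀ a b, ∃ m : ℤ, h a b - (v a + v b - v (a * b)) = m := by
    intro a b
    apply hq0
    rw [map_sub, map_sub, map_add, hv, hv, hv, hu, sub_self]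
  choose w hw using key
  refine ⟨w, fun a b c => ?_⟩
  have : (f a b c : ℚ) = (w b c - w (a * b) c + w a (b * c) - w a b : ℚ) := by
    rw [← hh, ← hw, ← hw, ← hw, ← hw, mul_assoc]
    ring
  exact_mod_cast this

theorem d3 {G : Type} [Group G] (F : (Fin 3 → G) → ℤ) (a b c e : G) :
    (inhomogeneousCochains.d (Rep.trivial ℤ G ℤ) 3).hom F ![a, b, c, e] =
      F ![b, c, e] - F ![a * b, c, e] + F ![a, b * c, e] - F ![a, b, c * e] + F ![a, b, c] := by
  rw [inhomogeneousCochains.d_hom_apply]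
  have h0 : Fin.contractNth (0 : Fin 4) (· * ·) ![a, b, c, e] = ![a * b, c, e] := by
    funext i; fin_cases i <;> rfl
  have h1 : Fin.contractNth (1 : Fin 4) (· * ·) ![a, b, c, e] = ![a, b * c, e] := by
    funext i; fin_cases i <;> rfl
  have h2 : Fin.contractNth (2 : Fin 4) (· * ·) ![a, b, c, e] = ![a, b, c * e] := by
    funext i; fin_cases i <;> rfl
  have h3 : Fin.contractNth (3 : Fin 4) (· * ·) ![a, b, c, e] = ![a, b, c] := by
    funext i; fin_cases i <;> rfl
  have h4 : (fun i : Fin 3 => ![a, b, c, e] i.succ) = ![b, c, e] := by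
    funext i; fin_cases i <;> rfl
  rw [Fin.sum_univ_four, h0, h1, h2, h3, h4]
  change F ![b, c, e] + ((-1 : ℤ) ^ (0 + 1) * F ![a * b, c, e] + (-1 : ℤ) ^ (1 + 1) * F ![a, b * c, e]
    + (-1 : ℤ) ^ (2 + 1) * F ![a, b, c * e] + (-1 : ℤ) ^ (3 + 1) * F ![a, b, c]) = _
  ring

theorem d2 {G : Type} [Group G] (F : (Fin 2 → G) → ℤ) (a b c : G) :
    (inhomogeneousCochains.d (Rep.trivial ℤ G ℤ) 2).hom F ![a, b, c] =
      F ![b, c] - F ![a * b, c] + F ![a, b * c] - F ![a, b] := by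
  rw [inhomogeneousCochains.d_hom_apply]
  have h0 : Fin.contractNth (0 : Fin 3) (· * ·) ![a, b, c] = ![a * b, c] := by
    funext i; fin_cases i <;> rfl
  have h1 : Fin.contractNth (1 : Fin 3) (· * ·) ![a, b, c] = ![a, b * c] := by
    funext i; fin_cases i <;> rfl
  have h2 : Fin.contractNth (2 : Fin 3) (· * ·) ![a, b, c] = ![a, b] := by
    funext i; fin_cases i <;> rfl
  have h4 : (fun i : Fin 2 => ![a, b, c] i.succ) = ![b, c] := by
    funext i; fin_cases i <;> rfl
  rw [Fin.sum_univ_three, h0, h1, h2, h4]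
  change F ![b, c] + ((-1 : ℤ) ^ (0 + 1) * F ![a * b, c] + (-1 : ℤ) ^ (1 + 1) * F ![a, b * c]
    + (-1 : ℤ) ^ (2 + 1) * F ![a, b]) = _
  ring

end AF9

/-- The quaternionic case of Lemma 4.2: the third group cohomology, with trivial integral
coefficients, of the generalized quaternion group of order `2^(k+2)` (the dicyclic group
`QuaternionGroup (2^k)` of order `4·2^k`) vanishes. -/
theorem almost_flat_stmt9 (k : ℕ) (hk : 1 ≤ k) :
    Subsingleton
      (groupCohomology (Rep.trivial ℤ (QuaternionGroup (2 ^ k)) ℤ) 3) := by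
  refine subsingleton_of_forall_eq 0 fun x => ?_
  induction x using groupCohomology_induction_on with | h z => ?_
  let R := Rep.trivial ℤ (QuaternionGroup (2 ^ k)) ℤ
  let F : (Fin 3 → QuaternionGroup (2 ^ k)) → ℤ := groupCohomology.iCocycles R 3 z
  have hF : inhomogeneousCochains.d R 3 F = 0 := by
    have h1 := (groupCohomology.inhomogeneousCochains R).iCycles_d 3 4
    rw [groupCohomology.inhomogeneousCochains.d_def] at h1
    exact congrArg (fun φ => φ.hom z) h1
  obtain ⟨w, hw⟩ := AF9.cochain (n := 2 ^ k) (fun a b c => F ![a, b, c]) (by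
    intro a b c e
    have h2 := congrFun hF ![a, b, c, e]
    exact (AF9.d3 F a b c e).symm.trans h2)
  let W : (Fin 2 → QuaternionGroup (2 ^ k)) → ℤ := fun g => w (g 0) (g 1)
  have hW : inhomogeneousCochains.d R 2 W = F := by
    funext g
    have hg : g = ![g 0, g 1, g 2] := by
      funext i; fin_cases i <;> rfl
    rw [hg]
    exact (AF9.d2 W (g 0) (g 1) (g 2)).trans (hw _ _ _).symm
  have hz : z = groupCohomology.toCocycles R 2 3 W := by
    apply (ModuleCat.mono_iff_injective (groupCohomology.iCocycles R 3)).1 inferInstance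
    have h1 := (groupCohomology.inhomogeneousCochains R).toCycles_i 2 3
    rw [groupCohomology.inhomogeneousCochains.d_def] at h1
    exact hW.symm.trans (congrArg (fun φ => φ.hom W) h1).symm
  rw [hz]
  exact congrArg (fun φ => φ.hom W)
    ((groupCohomology.inhomogeneousCochains R).toCycles_comp_homologyπ 2 3)
end

section
/- Let G be a finite group and let P be a 2-Sylow subgroup of G. If P is cyclic or P is isomorphic to a generalized quaternion group QuaternionGroup (2^k) for some k ≥ 1, then the third group cohomology H³(P; ℤ) of P with trivial coefficients ℤ is trivial. -/
/-- The underlying type of the central extension attached to a 2-cochain. -/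
@[ext]
structure CocExt {D G : Type} (h : G → G → D) : Type where
  fst : D
  snd : G

section
variable {D G : Type} [AddCommGroup D] [Group G] (h : G → G → D)

/-- The group structure of the central extension attached to a 2-cocycle. -/
@[reducible]
def CocExt.group (hh : ∀ a b c, h b c - h (a*b) c + h a (b*c) - h a b = 0) :
    Group (CocExt h) :=
  letI : Mul (CocExt h) := ⟨fun x y => ⟨x.1 + y.1 + h x.2 y.2, x.2 * y.2⟩⟩
  letI : One (CocExt h) := ⟨⟨- h 1 1, 1⟩⟩
  letI : Inv (CocExt h) := ⟨fun x => ⟨- x.1 - h x.2⁻¹ x.2 - h 1 1, x.2⁻¹⟩⟩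
  Group.ofLeftAxioms
    (by
      rintro ⟨a, x⟩ ⟨b, y⟩ ⟨c, z⟩
      refine CocExt.ext ?_ (mul_assoc x y z)
      show a + b + h x y + c + h (x*y) z = a + (b + c + h y z) + h x (y * z)
      have := hh x y z
      rw [← sub_eq_zero, ← neg_eq_zero, ← this]; abel)
    (by
      rintro ⟨a, x⟩
      refine CocExt.ext ?_ (one_mul x)
      show - h 1 1 + a + h 1 x = a
      have := hh 1 1 x
      simp only [one_mul] at this
      rw [← sub_eq_zero, ← this]; abel)
    (by
      rintro ⟨a, x⟩
      refine CocExt.ext ?_ (inv_mul_cancel x)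
      show - a - h x⁻¹ x - h 1 1 + a + h x⁻¹ x = - h 1 1
      abel)

/-- splitting property -/
def Splits (P : Type) [Group P] : Prop :=
  ∀ (E : Type) [Group E] (p : E →* P), Function.Surjective p →
    (∀ z, p z = 1 → ∀ y, z * y = y * z) →
    (∀ z, p z = 1 → ∀ n : ℕ, n ≠ 0 → ∃ w, p w = 1 ∧ w ^ n = z) →
    ∃ s : P →* E, ∀ x, p (s x) = x

lemma splits_cob {G : Type} [Group G] (hG : Splits G) {D : Type} [AddCommGroup D]
    (hD : ∀ d : D, ∀ n : ℕ, n ≠ 0 → ∃ e, n • e = d) (h : G → G → D)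
    (hh : ∀ a b c, h b c - h (a*b) c + h a (b*c) - h a b = 0) :
    ∃ u : G → D, ∀ a b, h a b = u (a * b) - u a - u b := by
  let _ := CocExt.group h hh
  have hmul : ∀ x y : CocExt h, x * y = ⟨x.1 + y.1 + h x.2 y.2, x.2 * y.2⟩ :=
    fun _ _ => rfl
  have hone : (1 : CocExt h) = ⟨- h 1 1, 1⟩ := rfl
  have h1 : ∀ x, h 1 x = h 1 1 := fun x => by
    have := hh 1 1 x
    simp only [one_mul] at this
    rw [← sub_eq_zero, ← this]; abel
  have h2 : ∀ x, h x 1 = h 1 1 := fun x => by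
    have := hh x 1 1
    simp only [mul_one] at this
    rw [eq_comm, ← sub_eq_zero, ← this]; abel
  let p : CocExt h →* G := ⟨⟨fun x => x.2, rfl⟩, fun _ _ => rfl⟩
  have hpow : ∀ (d : D) (n : ℕ),
      (⟨d - h 1 1, 1⟩ : CocExt h) ^ n = ⟨n • d - h 1 1, 1⟩ := by
    intro d n
    induction n with
    | zero => rw [pow_zero, hone]; simp
    | succ n ih =>
      rw [pow_succ, ih, hmul]
      refine CocExt.ext ?_ (mul_one 1)
      show n • d - h 1 1 + (d - h 1 1) + h 1 1 = (n+1) • d - h 1 1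
      rw [succ_nsmul]; abel
  obtain ⟨s, hs⟩ := hG (CocExt h) p (fun x => ⟨⟨0, x⟩, rfl⟩)
    (by
      rintro ⟨d, x⟩ hx ⟨e, y⟩
      obtain rfl : x = 1 := hx
      rw [hmul, hmul]
      refine CocExt.ext ?_ ((one_mul y).trans (mul_one y).symm)
      show d + e + h 1 y = e + d + h y 1
      rw [h1 y, h2 y, add_comm d e])
    (by
      rintro ⟨d, x⟩ hx n hn
      obtain rfl : x = 1 := hx
      obtain ⟨e, he⟩ := hD (d + h 1 1) n hn
      refine ⟨⟨e - h 1 1, 1⟩, rfl, (hpow e n).trans ?_⟩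
      rw [he]; simp)
  refine ⟨fun x => (s x).1, fun a b => ?_⟩
  have := s.map_mul a b
  rw [hmul] at this
  have h3 : (s (a*b)).1 = (s a).1 + (s b).1 + h (p (s a)) (p (s b)) := congrArg CocExt.fst this
  rw [hs, hs] at h3
  simp only [h3]; abel

lemma splits_equiv {G H : Type} [Group G] [Group H] (e : G ≃* H) (hH : Splits H) : Splits G := by
  intro E _ p hp hc hd
  obtain ⟨s, hs⟩ := hH E (e.toMonoidHom.comp p) (e.surjective.comp hp)
    (fun z hz => hc z (by simpa using hz))
    (fun z hz n hn => by
      obtain ⟨w, hw, hw'⟩ := hd z (by simpa using hz) n hn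
      exact ⟨w, by simp [hw], hw'⟩)
  exact ⟨s.comp e.toMonoidHom, fun x => e.injective (hs (e x))⟩

lemma splits_cyclic {G : Type} [Group G] [Finite G] [IsCyclic G] : Splits G := by
  intro E _ p hp hc hd
  obtain ⟨g, hg⟩ := IsCyclic.exists_generator (α := G)
  obtain ⟨α, rfl⟩ := hp g
  obtain ⟨c, hc1, hcn⟩ := hd (α ^ orderOf (p α))⁻¹ (by simp [pow_orderOf_eq_one]) (orderOf (p α))
    (orderOf_pos _).ne'
  refine ⟨monoidHomOfForallMemZpowers hg (g' := c * α) ?_, fun x => ?_⟩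
  · apply orderOf_dvd_of_pow_eq_one
    rw [Commute.mul_pow (hc c hc1 α), hcn, inv_mul_cancel]
  · obtain ⟨k, rfl⟩ := hg x
    simp only [map_zpow, monoidHomOfForallMemZpowers_apply_gen]
    simp [hc1]

lemma splits_quat (n : ℕ) [NeZero n] : Splits (QuaternionGroup n) := by
  intro E _ p hp hc hd
  obtain ⟨α₀, hα₀⟩ := hp (.a 1)
  obtain ⟨ξ₀, hξ₀⟩ := hp (.xa 0)
  have hinv : ∀ i : ZMod (2*n), (QuaternionGroup.a i)⁻¹ = .a (-i) := fun i => rfl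
  have hinvx : ∀ i : ZMod (2*n), (QuaternionGroup.xa i)⁻¹ = .xa (n + i) := fun i => rfl
  have h2n : (n : ZMod (2*n)) + n = 0 := by
    have := ZMod.natCast_self (2*n); push_cast at this; rw [← this]; ring
  obtain ⟨c, hc1, hc2⟩ := hd (ξ₀ * α₀ * ξ₀⁻¹ * α₀)⁻¹
    (by
      simp only [map_inv, map_mul, hα₀, hξ₀]
      rw [inv_eq_one, hinvx]
      simp [← add_assoc, h2n, pow_two]) 2 two_ne_zero
  have key : ξ₀ * (α₀ * c) * ξ₀⁻¹ = (α₀ * c)⁻¹ := by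
    rw [eq_inv_iff_mul_eq_one]
    calc ξ₀ * (α₀ * c) * ξ₀⁻¹ * (α₀ * c) = ξ₀ * α₀ * (c * (ξ₀⁻¹ * α₀)) * c := by group
      _ = ξ₀ * α₀ * ξ₀⁻¹ * α₀ * c ^ 2 := by rw [hc c hc1]; simp only [mul_assoc, pow_two]
      _ = 1 := by rw [hc2, mul_inv_cancel]
  obtain ⟨α, hα⟩ : ∃ α, α = α₀ * c := ⟨_, rfl⟩
  rw [← hα] at key
  have hpα : p α = .a 1 := by rw [hα]; simp [hα₀, hc1]
  have hpow : p (α ^ n) = .a n := by rw [map_pow, hpα]; exact QuaternionGroup.a_one_pow n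
  obtain ⟨e, he1, he2⟩ := hd (ξ₀ ^ 2 * (α ^ n)⁻¹)⁻¹
    (by
      simp only [map_inv, map_mul, hpow, map_pow p ξ₀, hξ₀]
      rw [inv_eq_one, hinv]
      simp [pow_two, h2n]) 2 two_ne_zero
  obtain ⟨ξ, hξ⟩ : ∃ ξ, ξ = ξ₀ * e := ⟨_, rfl⟩
  have hpξ : p ξ = .xa 0 := by rw [hξ]; simp [hξ₀, he1]
  have hconj : ξ * α * ξ⁻¹ = α⁻¹ := by
    rw [hξ, ← key]
    calc ξ₀ * e * α * (ξ₀ * e)⁻¹ = ξ₀ * (e * α) * (e⁻¹ * ξ₀⁻¹) := by group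
      _ = _ := by rw [hc e he1]; group
  have hsq : ξ ^ 2 = α ^ n := by
    rw [hξ, ((Commute.mul_pow (hc e he1 ξ₀).symm 2)), he2]
    have : Commute (ξ₀ ^ 2) (e ^ 2) := Commute.pow_pow (hc e he1 ξ₀).symm 2 2
    rw [he2] at this
    rw [this.eq]; group
  have hk : ∀ k : ℤ, ξ * α ^ k = α ^ (-k) * ξ := fun k => by
    have : (ξ * α * ξ⁻¹) ^ k = ξ * α ^ k * ξ⁻¹ := conj_zpow
    rw [hconj, inv_zpow'] at this
    rw [this]; group
  have hord : α ^ ((2 * n : ℕ) : ℤ) = 1 := by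
    have h1 := hk n
    rw [zpow_natCast, ← hsq] at h1
    have h2 : ξ ^ 2 * ξ = α ^ (-(n:ℤ)) * ξ := by rw [← h1]; group
    have h3 := mul_right_cancel h2
    rw [hsq, zpow_neg, zpow_natCast, eq_inv_iff_mul_eq_one, ← pow_add, ← two_mul] at h3
    rw [zpow_natCast, h3]
  let F : ZMod (2*n) →+ Additive E :=
    ZMod.lift (2*n) ⟨(zmultiplesHom (Additive E)) (Additive.ofMul α), by
      simpa [← ofMul_zpow] using hord⟩
  have hF : ∀ k : ℤ, (F (k : ZMod (2*n))).toMul = α ^ k := fun k => by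
    simp [F, ZMod.lift_coe]
  let s : QuaternionGroup n → E := fun x => match x with
    | .a i => (F i).toMul
    | .xa i => ξ * (F i).toMul
  have hsa : ∀ k : ℤ, s (.a k) = α ^ k := hF
  have hsx : ∀ k : ℤ, s (.xa k) = ξ * α ^ k := fun k => congrArg (ξ * ·) (hF k)
  refine ⟨MonoidHom.mk' s ?_, ?_⟩
  · have hsxx : ξ * ξ = α ^ (n : ℤ) := by rw [← pow_two, hsq, zpow_natCast]
    rintro (i | i) (j | j) <;> obtain ⟨i, rfl⟩ := ZMod.intCast_surjective i <;>
      obtain ⟨j, rfl⟩ := ZMod.intCast_surjective j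
    · rw [QuaternionGroup.a_mul_a, ← Int.cast_add, hsa, hsa, hsa, zpow_add]
    · rw [QuaternionGroup.a_mul_xa, ← Int.cast_sub, hsa, hsx, hsx, sub_eq_neg_add, zpow_add,
        ← mul_assoc, hk, ← mul_assoc, neg_neg]
    · rw [QuaternionGroup.xa_mul_a, ← Int.cast_add, hsa, hsx, hsx, zpow_add, mul_assoc]
    · rw [QuaternionGroup.xa_mul_xa, ← Int.cast_natCast, ← Int.cast_add, ← Int.cast_sub, hsa, hsx,
        hsx]
      calc _ = α ^ (-i) * α ^ (n:ℤ) * α ^ j := by rw [← zpow_add, ← zpow_add]; congr 1; ring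
        _ = _ := by rw [← hsxx, hk]; group
  · have haz : ∀ k : ℤ, (QuaternionGroup.a 1 : QuaternionGroup n) ^ k = .a k := fun k => by
      obtain ⟨m, rfl | rfl⟩ := k.eq_nat_or_neg
      · simp
      · simp [hinv]
    rintro (i | i) <;> obtain ⟨i, rfl⟩ := ZMod.intCast_surjective i
    · show p (s (.a (i : ZMod (2*n)))) = _
      rw [hsa, map_zpow, hpα, haz]
    · show p (s (.xa (i : ZMod (2*n)))) = _
      rw [hsx, map_mul, map_zpow, hpα, haz, hpξ]
      simp

lemma splits_coh (G : Type) [Group G] [Finite G] (hG : Splits G) (F : G → G → G → ℤ)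
    (hF : ∀ a b c e, F b c e - F (a*b) c e + F a (b*c) e - F a b (c*e) + F a b c = 0) :
    ∃ k : G → G → ℤ, ∀ a b c, k b c - k (a*b) c + k a (b*c) - k a b = F a b c := by
  have := Fintype.ofFinite G
  let N : ℚ := Fintype.card G
  have hN : N ≠ 0 := by simp [N]
  let H : G → G → ℤ := fun a b => ∑ e, F a b e
  have hH : ∀ a b c, H b c - H (a*b) c + H a (b*c) - H a b + Fintype.card G * F a b c = 0 := by
    intro a b c
    have h1 : ∑ e, (F b c e - F (a*b) c e + F a (b*c) e - F a b (c*e) + F a b c) = 0 :=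
      Finset.sum_eq_zero fun e _ => hF a b c e
    have h2 : ∑ e, F a b (c * e) = ∑ e, F a b e :=
      Fintype.sum_equiv (Equiv.mulLeft c) _ _ fun _ => rfl
    simpa [Finset.sum_add_distrib, Finset.sum_sub_distrib, h2] using h1
  let h : G → G → ℚ := fun a b => - (H a b : ℚ) / N
  have hh : ∀ a b c, h b c - h (a*b) c + h a (b*c) - h a b = F a b c := by
    intro a b c
    have : ((H b c : ℚ) - H (a*b) c + H a (b*c) - H a b + N * F a b c) = 0 := by
      have := hH a b c
      simp only [N]
      exact_mod_cast this
    simp only [h]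
    field_simp
    linarith
  have hint : ∀ n : ℤ, ((n : ℚ) : AddCircle (1 : ℚ)) = 0 := fun n =>
    (AddCircle.coe_eq_zero_iff 1).2 ⟨n, by simp⟩
  obtain ⟨u, hu⟩ := splits_cob hG (D := AddCircle (1 : ℚ))
    (fun d n hn => by
      obtain ⟨q, rfl⟩ := QuotientAddGroup.mk_surjective d
      refine ⟨((q / n : ℚ) : AddCircle (1:ℚ)), ?_⟩
      have : n • (q / n : ℚ) = q := by
        have : (n : ℚ) ≠ 0 := by exact_mod_cast hn
        rw [nsmul_eq_mul, mul_div_cancel₀ _ this]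
      rw [← AddCircle.coe_nsmul, this])
    (fun a b => (h a b : AddCircle (1:ℚ)))
    (fun a b c => by
      have := hint (F a b c)
      rw [← hh] at this
      exact_mod_cast this)
  choose v hv using fun x => QuotientAddGroup.mk_surjective (u x)
  have hk : ∀ a b, ∃ k : ℤ, (k : ℚ) = h a b - (v (a*b) - v a - v b) := fun a b => by
    have h0 : ((h a b - (v (a*b) - v a - v b) : ℚ) : AddCircle (1:ℚ)) = 0 := by
      have := hu a b
      rw [← hv, ← hv, ← hv] at this
      rw [AddCircle.coe_sub, this]
      exact sub_self _
    obtain ⟨k, hk⟩ := (AddCircle.coe_eq_zero_iff 1).1 h0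
    exact ⟨k, by simpa using hk⟩
  choose k hk using hk
  refine ⟨k, fun a b c => ?_⟩
  have : (k b c : ℚ) - k (a*b) c + k a (b*c) - k a b = F a b c := by
    rw [hk, hk, hk, hk, ← hh, mul_assoc]; ring
  exact_mod_cast this

lemma splits_subsingleton (G : Type) [Group G] [Finite G] (hG : Splits G) :
    Subsingleton (groupCohomology (Rep.trivial ℤ G ℤ) 3) := by
  apply ModuleCat.subsingleton_of_isZero
  unfold groupCohomology
  rw [← HomologicalComplex.exactAt_iff_isZero_homology,
    HomologicalComplex.exactAt_iff' _ 2 3 4 (by simp) (by simp),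
    CategoryTheory.ShortComplex.moduleCat_exact_iff]
  intro f hf
  replace hf : (inhomogeneousCochains.d (Rep.trivial ℤ G ℤ) 3) f = 0 := by
    rw [← groupCohomology.inhomogeneousCochains.d_def]; exact hf
  change (Fin 3 → G) → ℤ at f
  obtain ⟨k, hk⟩ := splits_coh G hG (fun a b c => f ![a, b, c]) (fun a b c e => by
    have := congrFun hf ![a, b, c, e]
    rw [inhomogeneousCochains.d_hom_apply] at this
    simp [Fin.sum_univ_succ] at this
    have e0 : Fin.contractNth 0 (fun x1 x2 => x1 * x2) ![a, b, c, e] = ![a * b, c, e] := by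
      funext i; fin_cases i <;> rfl
    have e1 : Fin.contractNth 1 (fun x1 x2 => x1 * x2) ![a, b, c, e] = ![a, b * c, e] := by
      funext i; fin_cases i <;> rfl
    have e2 : Fin.contractNth 2 (fun x1 x2 => x1 * x2) ![a, b, c, e] = ![a, b, c * e] := by
      funext i; fin_cases i <;> rfl
    have e3 : Fin.contractNth 3 (fun x1 x2 => x1 * x2) ![a, b, c, e] = ![a, b, c] := by
      funext i; fin_cases i <;> rfl
    rw [e0, e1, e2, e3] at this
    have h' : f ![b, c, e] + (-f ![a * b, c, e] + (f ![a, b * c, e] + (-f ![a, b, c * e] +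
      f ![a, b, c]))) = 0 := this
    linarith)
  refine ⟨fun x => k (x 0) (x 1), ?_⟩
  show ((groupCohomology.inhomogeneousCochains (Rep.trivial ℤ G ℤ)).d 2 3) _ = _
  rw [groupCohomology.inhomogeneousCochains.d_def]
  funext x
  rw [inhomogeneousCochains.d_hom_apply]
  have := hk (x 0) (x 1) (x 2)
  simp [Fin.sum_univ_succ]
  have hx : ![x 0, x 1, x 2] = x := by funext i; fin_cases i <;> rfl
  rw [hx] at this
  show k (x 1) (x 2) + (-k (x 0 * x 1) (x 2) + (k (x 0) (x 1 * x 2) + -k (x 0) (x 1))) = f x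
  linarith

end

/-- Lemma 4.2: if a `2`-Sylow subgroup `P` of a finite group `G` is cyclic or generalized
quaternionic, then `H³(P; ℤ)`, the third group cohomology of `P` with trivial integral
coefficients, vanishes. -/
theorem almost_flat_stmt10 (G : Type) [Group G] [Finite G] (P : Sylow 2 G)
    (hP : IsCyclic P ∨ ∃ k : ℕ, 1 ≤ k ∧ Nonempty (P ≃* QuaternionGroup (2 ^ k))) :
    Subsingleton (groupCohomology (Rep.trivial ℤ P ℤ) 3) := by
  apply splits_subsingleton
  rcases hP with h | ⟨k, -, ⟨e⟩⟩
  · exact splits_cyclic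
  · exact splits_equiv e (splits_quat _)
end
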